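/- arXiv:2507.18779 — 3 statements merged into one kernel-verified Lean document; each statement's English description precedes it below -/
import Mathlib

section
/- Let X be a shift space on a finite alphabet with language L and topological entropy h, satisfying e^{nh} ≤ #L_n ≤ C₂ e^{nh} for all n and some constant C₂. Suppose G ⊆ L satisfies: (III) there exists T ∈ ℕ such that for all u, v, w, x ∈ G there are p, q, r ∈ L_T with upvqwrx ∈ L; and there exist θ > 0 and M ∈ ℕ such that for every n ∈ ℕ there is j ∈ [n − 2M, n] ∩ ℕ with #G_j ≥ θ e^{nh}. Then there exist a measure of maximal entropy μ on X and a constant c > 0 such that μ([w]) ≥ c e^{−|w|h} for all w ∈ G, and μ([u] ∩ σ^{−(|u|+T)}[v]) ≥ c e^{−(|u|+|v|)h} for all u, v ∈ G. -/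
open MeasureTheory Filter Real Set

/-- The left shift on bi-infinite sequences. -/
def shift {A : Type*} (x : ℤ → A) : ℤ → A := fun n => x (n + 1)

/-- `w` occurs as a factor (finite subword) of the bi-infinite sequence `x`. -/
def FactorOf {A : Type*} (w : List A) (x : ℤ → A) : Prop :=
  ∃ i : ℤ, ∀ t : ℕ, (ht : t < w.length) → x (i + t) = w[t]

/-- `ℓ` is a period of the word `w`. -/
def HasPeriodN {A : Type*} (w : List A) (ℓ : ℕ) : Prop :=
  1 ≤ ℓ ∧ ℓ ≤ w.length ∧ ∀ t : ℕ, (ht : t + ℓ < w.length) →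
    w[t]'(lt_of_le_of_lt (Nat.le_add_right t ℓ) ht) = w[t + ℓ]

/-- The `d`-ary `β`-free shift. -/
def betaFree (d : ℕ) (β : ℝ) : Set (ℤ → Fin d) :=
  {x | ∀ w : List (Fin d), FactorOf w x → ∀ ℓ : ℕ, HasPeriodN w ℓ → (w.length : ℝ) < β * ℓ}

/-- The language of a shift space. -/
def language {A : Type*} (X : Set (ℤ → A)) : Set (List A) :=
  {w | ∃ x ∈ X, FactorOf w x}

/-- The words of length `n` in the language of `X`. -/
def langN {A : Type*} (X : Set (ℤ → A)) (n : ℕ) : Set (List A) :=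
  {w | w ∈ language X ∧ w.length = n}

/-- The cylinder of a word. -/
def cylinder {A : Type*} (w : List A) : Set (ℤ → A) :=
  {x | ∀ t : ℕ, (ht : t < w.length) → x (t : ℤ) = w[t]}

/-- A shift space: closed and shift-invariant. -/
def IsShiftSpace {A : Type*} [TopologicalSpace A] (X : Set (ℤ → A)) : Prop :=
  IsClosed X ∧ shift '' X = X

/-- Invariance of a measure under the shift. -/
def IsShiftInvariant {A : Type*} [MeasurableSpace A] (μ : Measure (ℤ → A)) : Prop :=
  ∀ E : Set (ℤ → A), MeasurableSet E → μ (shift ⁻¹' E) = μ E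

/-- The `n`-th partition sum `H_n(μ) = Σ_w −μ[w] log μ[w]`. -/
noncomputable def cylEntropySum {A : Type*} [Fintype A] [MeasurableSpace A]
    (μ : Measure (ℤ → A)) (n : ℕ) : ℝ :=
  ∑ w : Fin n → A, Real.negMulLog (μ (cylinder (List.ofFn w))).toReal

/-- `μ` is a measure of maximal entropy on `X` (with topological entropy `h`). -/
def IsMME {A : Type*} [Fintype A] [MeasurableSpace A]
    (X : Set (ℤ → A)) (h : ℝ) (μ : Measure (ℤ → A)) : Prop :=
  IsProbabilityMeasure μ ∧ μ X = 1 ∧ IsShiftInvariant μ ∧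
    Tendsto (fun n : ℕ => cylEntropySum μ n / n) atTop (nhds h)

/-- A word is a 4-power. -/
def IsFourPower {A : Type*} (s : List A) : Prop :=
  ∃ v : List A, v ≠ [] ∧ s = v ++ v ++ v ++ v

/-- Good words: words of the language no prefix or suffix of which is a 4-power. -/
def goodWords {A : Type*} (X : Set (ℤ → A)) : Set (List A) :=
  {w | w ∈ language X ∧ (∀ p : List A, p <+: w → ¬ IsFourPower p) ∧
       (∀ s : List A, s <:+ w → ¬ IsFourPower s)}

/-- Words of the language that are concatenations of 4-powers of words of the language. -/
def fourPowerConcat {A : Type*} (X : Set (ℤ → A)) : Set (List A) :=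
  {w | w ∈ language X ∧ ∃ ps : List (List A),
      (∀ p ∈ ps, ∃ v ∈ language X, v ≠ [] ∧ p = v ++ v ++ v ++ v) ∧ w = ps.flatten}

/-- Alternating concatenation `w₁u₁w₂u₂⋯`. -/
def alternate {A : Type*} : List (List A) → List (List A) → List A
  | [], _ => []
  | w :: _, [] => w
  | w :: ws, u :: us => w ++ u ++ alternate ws us

/-- The map deleting the first `i` and the last `k` symbols of a word. -/
def phi {A : Type*} (i k : ℕ) (w : List A) : List A := (w.drop i).take (w.length - i - k)

/-- Maximal `k` such that the first `k` symbols of `w` follow the periodic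
pattern of period `ℓ` determined by the prefix of `w` of length `ℓ`. -/
noncomputable def preK {A : Type*} (w : List A) (ℓ : ℕ) : ℕ :=
  sSup {k | k ≤ w.length ∧ ∀ t < k, w[t]? = w[t % ℓ]?}

/-- `pre_ℓ(w)`: the number of times the length-`ℓ` prefix of `w` repeats at the start of `w`. -/
noncomputable def pre {A : Type*} (w : List A) (ℓ : ℕ) : ℝ := (preK w ℓ : ℝ) / ℓ

/-- `suf_ℓ(w)`: the number of times the length-`ℓ` suffix of `w` repeats at the end of `w`. -/
noncomputable def suf {A : Type*} (w : List A) (ℓ : ℕ) : ℝ := pre w.reverse ℓ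

/-- The translate of a bi-infinite sequence by `k` places. -/
def translateSeq {A : Type*} (k : ℤ) (x : ℤ → A) : ℤ → A := fun i => x (i + k)

/-- The word of length `m` read in `x` from position `i` on. -/
def wordAt {A : Type*} (x : ℤ → A) (i : ℤ) (m : ℕ) : List A :=
  List.ofFn fun t : Fin m => x (i + (t : ℕ))

/-- The word `w` occurs in `x` at position `i`. -/
def OccursAt {A : Type*} (w : List A) (x : ℤ → A) (i : ℤ) : Prop :=
  ∀ t : ℕ, (ht : t < w.length) → x (i + t) = w[t]

section Words

variable {A : Type*}

theorem shift_eq_translateSeq : (shift : (ℤ → A) → ℤ → A) = translateSeq 1 := rfl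

theorem translateSeq_translateSeq (j k : ℤ) (x : ℤ → A) :
    translateSeq j (translateSeq k x) = translateSeq (j + k) x := by
  funext i
  simp [translateSeq, add_assoc]

theorem iterate_shift (n : ℕ) (x : ℤ → A) : shift^[n] x = translateSeq n x := by
  induction n generalizing x with
  | zero => funext i; simp [translateSeq]
  | succ n ih =>
    rw [Function.iterate_succ_apply, ih, shift_eq_translateSeq, translateSeq_translateSeq]
    push_cast
    rfl

@[simp] theorem length_wordAt (x : ℤ → A) (i : ℤ) (m : ℕ) : (wordAt x i m).length = m := by
  simp [wordAt]

theorem wordAt_eq_iff {x y : ℤ → A} {i : ℤ} {m : ℕ} :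
    wordAt x i m = wordAt y i m ↔ ∀ t < m, x (i + (t : ℕ)) = y (i + (t : ℕ)) := by
  unfold wordAt
  rw [List.ofFn_inj]
  constructor
  · intro h t ht
    exact congrFun h ⟨t, ht⟩
  · intro h
    funext t
    exact h t t.2

theorem occursAt_iff_wordAt {w : List A} {x : ℤ → A} {i : ℤ} :
    OccursAt w x i ↔ wordAt x i w.length = w := by
  constructor
  · intro h
    refine List.ext_getElem (by simp) fun t h₁ h₂ => ?_
    simpa [wordAt] using h t h₂
  · intro h t ht
    have := List.getElem_of_eq h (i := t) (by simpa using ht)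
    simpa [wordAt] using this

theorem occursAt_append {u v : List A} {x : ℤ → A} {i : ℤ} :
    OccursAt (u ++ v) x i ↔ OccursAt u x i ∧ OccursAt v x (i + u.length) := by
  constructor
  · intro h
    refine ⟨fun t ht => ?_, fun t ht => ?_⟩
    · rw [h t (by simp; omega), List.getElem_append_left ht]
    · have := h (u.length + t) (by simp; omega)
      rw [List.getElem_append_right (by omega)] at this
      simpa [add_assoc] using this
  · rintro ⟨hu, hv⟩ t ht
    by_cases hlt : t < u.length
    · rw [hu t hlt, List.getElem_append_left hlt]
    · rw [List.getElem_append_right (by omega), ← hv (t - u.length) (by simp at ht; omega)]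
      congr 1
      push_cast [Nat.cast_sub (not_lt.mp hlt)]
      ring

theorem occursAt_translateSeq {w : List A} {x : ℤ → A} {i k : ℤ} :
    OccursAt w (translateSeq k x) i ↔ OccursAt w x (i + k) := by
  simp only [OccursAt, translateSeq]
  simp only [add_right_comm]

theorem OccursAt.congr {w : List A} {x y : ℤ → A} {i : ℤ} (h : OccursAt w x i)
    (hxy : ∀ j, i ≤ j → j < i + w.length → x j = y j) : OccursAt w y i := by
  intro t ht
  rw [← h t ht, hxy _ (by omega) (by omega)]

theorem mem_cylinder_iff_occursAt {w : List A} {x : ℤ → A} : x ∈ cylinder w ↔ OccursAt w x 0 := by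
  simp [_root_.cylinder, OccursAt]

theorem mem_cylinder_ofFn {m : ℕ} {w : Fin m → A} {x : ℤ → A} :
    x ∈ _root_.cylinder (List.ofFn w) ↔ wordAt x 0 m = List.ofFn w := by
  rw [mem_cylinder_iff_occursAt, occursAt_iff_wordAt, List.length_ofFn]

theorem translateSeq_mem [TopologicalSpace A] {X : Set (ℤ → A)} (hX : IsShiftSpace X) (k : ℤ)
    {x : ℤ → A} (hx : x ∈ X) : translateSeq k x ∈ X := by
  induction k using Int.induction_on with
  | zero =>
    convert hx using 1
    funext i
    simp [translateSeq]
  | succ n ih =>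
    rw [add_comm, ← translateSeq_translateSeq, ← shift_eq_translateSeq, ← hX.2]
    exact ⟨_, ih, rfl⟩
  | pred n ih =>
    rw [← hX.2] at ih
    obtain ⟨y, hy, hyx⟩ := ih
    rw [sub_eq_neg_add, ← translateSeq_translateSeq, ← hyx, shift_eq_translateSeq, translateSeq_translateSeq]
    convert hy using 1
    funext i
    simp [translateSeq]

theorem exists_occursAt [TopologicalSpace A] {X : Set (ℤ → A)} (hX : IsShiftSpace X)
    {w : List A} (hw : w ∈ language X) (i : ℤ) : ∃ x ∈ X, OccursAt w x i := by
  obtain ⟨x, hx, j, hj⟩ := hw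
  refine ⟨translateSeq (j - i) x, translateSeq_mem hX _ hx, ?_⟩
  rw [occursAt_translateSeq, add_sub_cancel]
  exact hj

theorem wordAt_mem_langN {X : Set (ℤ → A)} {x : ℤ → A} (hx : x ∈ X) (i : ℤ) (m : ℕ) :
    wordAt x i m ∈ langN X m := by
  refine ⟨⟨x, hx, i, ?_⟩, length_wordAt x i m⟩
  exact occursAt_iff_wordAt.2 (by simp)

theorem image_wordAt [TopologicalSpace A] {X : Set (ℤ → A)} (hX : IsShiftSpace X)
    (i : ℤ) (m : ℕ) : (fun x => wordAt x i m) '' X = langN X m := by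
  ext w
  constructor
  · rintro ⟨x, hx, rfl⟩
    exact wordAt_mem_langN hx i m
  · rintro ⟨hw, rfl⟩
    obtain ⟨x, hx, hxw⟩ := exists_occursAt hX hw i
    exact ⟨x, hx, occursAt_iff_wordAt.1 hxw⟩

theorem finite_langN [Finite A] (X : Set (ℤ → A)) (m : ℕ) : (langN X m).Finite :=
  (List.finite_length_eq A m).subset fun _ hw => hw.2

theorem exists_separated_spanning [Finite A] [TopologicalSpace A] {X : Set (ℤ → A)}
    (hX : IsShiftSpace X) (i : ℤ) (m : ℕ) :
    ∃ S : Finset (ℤ → A), (∀ x ∈ S, x ∈ X) ∧ Set.InjOn (fun x => wordAt x i m) (S : Set (ℤ → A)) ∧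
      S.card = (langN X m).ncard ∧ ∀ x ∈ X, ∃ y ∈ S, wordAt y i m = wordAt x i m := by
  have hsurj : Set.SurjOn (fun x => wordAt x i m) X (langN X m) := (image_wordAt hX i m).ge
  obtain ⟨s, hsX, hs⟩ := hsurj.exists_bijOn_subset
  have hfin : s.Finite := hs.finite_iff_finite.2 (finite_langN X m)
  refine ⟨hfin.toFinset, fun x hx => hsX (by simpa using hx), by simpa using hs.injOn, ?_, ?_⟩
  · rw [← Set.ncard_eq_toFinset_card s hfin, ← hs.image_eq, hs.injOn.ncard_image]
  · intro x hx
    obtain ⟨y, hy, hyx⟩ := hs.surjOn (wordAt_mem_langN hx i m)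
    exact ⟨y, by simpa using hy, hyx⟩

open Classical in
theorem card_filter_occursAt_le [Finite A] {X : Set (ℤ → A)} {S : Finset (ℤ → A)}
    (hSX : ∀ x ∈ S, x ∈ X) (i : ℤ) (a b : ℕ) (w : List A)
    (hinj : Set.InjOn (fun x => wordAt x i (a + w.length + b)) (S : Set (ℤ → A))) :
    (S.filter fun x => OccursAt w x (i + a)).card ≤ (langN X a).ncard * (langN X b).ncard := by
  rw [← Set.ncard_coe_finset, ← Set.ncard_prod]
  refine Set.ncard_le_ncard_of_injOn
    (fun x => (wordAt x i a, wordAt x (i + a + w.length) b)) ?_ ?_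
    ((finite_langN X a).prod (finite_langN X b))
  · intro x hx
    have hxX := hSX x (by simp at hx; exact hx.1)
    exact ⟨wordAt_mem_langN hxX _ _, wordAt_mem_langN hxX _ _⟩
  · intro x hx y hy hxy
    simp only [Finset.coe_filter, Set.mem_ofPred_eq] at hx hy
    simp only [Prod.mk.injEq, wordAt_eq_iff] at hxy
    refine hinj hx.1 hy.1 (wordAt_eq_iff.2 fun t ht => ?_)
    rcases lt_or_ge t a with h₁ | h₁
    · exact hxy.1 t h₁
    rcases lt_or_ge t (a + w.length) with h₂ | h₂
    · have hx' := hx.2 (t - a) (by omega)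
      have hy' := hy.2 (t - a) (by omega)
      have e : i + (a : ℤ) + ((t - a : ℕ) : ℤ) = i + t := by omega
      rw [e] at hx' hy'
      rw [hx', hy']
    · have := hxy.2 (t - (a + w.length)) (by omega)
      have e : i + (a : ℤ) + w.length + ((t - (a + w.length) : ℕ) : ℤ) = i + t := by omega
      rwa [e] at this

open Classical in
theorem le_card_filter_of_forall_occursAt {S : Finset (ℤ → A)} {P : (ℤ → A) → Prop}
    {U V : Set (List A)} {a b : ℕ} (hU : ∀ u ∈ U, u.length = a) (hV : ∀ v ∈ V, v.length = b)
    (p q : ℤ)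
    (hS : ∀ u ∈ U, ∀ v ∈ V, ∃ x ∈ S, P x ∧ OccursAt u x p ∧ OccursAt v x q) :
    U.ncard * V.ncard ≤ (S.filter P).card := by
  rw [← Set.ncard_coe_finset, ← Set.ncard_prod]
  refine le_trans (Set.ncard_le_ncard (t := (fun x => (wordAt x p a, wordAt x q b)) ''
    (S.filter P : Set (ℤ → A))) ?_ ((Finset.finite_toSet _).image _))
    (Set.ncard_image_le (Finset.finite_toSet _))
  rintro ⟨u, v⟩ ⟨hu, hv⟩
  obtain ⟨x, hxS, hP, hxu, hxv⟩ := hS u hu v hv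
  refine ⟨x, by simp [hxS, hP], ?_⟩
  rw [occursAt_iff_wordAt, hU u hu] at hxu
  rw [occursAt_iff_wordAt, hV v hv] at hxv
  simp [hxu, hxv]

end Words

section Measures

variable {A : Type*}

theorem isClopen_setOf_occursAt [TopologicalSpace A] [DiscreteTopology A] (w : List A) (i : ℤ) :
    IsClopen {x : ℤ → A | OccursAt w x i} := by
  have : {x : ℤ → A | OccursAt w x i} =
      ⋂ t : Fin w.length, (fun x : ℤ → A => x (i + (t : ℕ))) ⁻¹' {w[t]} := by
    ext x
    simp only [OccursAt, Set.mem_ofPred_eq, Set.mem_iInter, Set.mem_preimage,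
      Set.mem_singleton_iff]
    exact ⟨fun h t => h t t.2, fun h t ht => h ⟨t, ht⟩⟩
  rw [this]
  exact isClopen_iInter_of_finite fun t =>
    (isClopen_discrete _).preimage (continuous_apply _)

theorem isClopen_cylinder [TopologicalSpace A] [DiscreteTopology A] (w : List A) : IsClopen (_root_.cylinder w) := by
  convert isClopen_setOf_occursAt w 0 using 1
  ext x
  exact mem_cylinder_iff_occursAt

theorem continuous_translateSeq [TopologicalSpace A] (k : ℤ) :
    Continuous (translateSeq k : (ℤ → A) → ℤ → A) :=
  continuous_pi fun i => continuous_apply (i + k)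

/-- The average over `k < n` and `x ∈ S` of the point masses at the translates of `x` by `k`. -/
noncomputable def orbitAverage [MeasurableSpace A] (S : Finset (ℤ → A)) (n : ℕ) :
    Measure (ℤ → A) :=
  ((n * S.card : ℕ) : ENNReal)⁻¹ • ∑ k ∈ Finset.range n, ∑ x ∈ S, Measure.dirac (translateSeq k x)

variable [MeasurableSpace A]

theorem isProbabilityMeasure_orbitAverage {S : Finset (ℤ → A)} (hS : S.Nonempty) {n : ℕ}
    (hn : n ≠ 0) : IsProbabilityMeasure (orbitAverage S n) := by
  constructor
  simp only [orbitAverage, Measure.smul_apply, Measure.finsetSum_apply, measure_univ,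
    Finset.sum_const, Finset.card_range, nsmul_eq_mul, mul_one, smul_eq_mul]
  rw [← Nat.cast_mul]
  refine ENNReal.inv_mul_cancel ?_ (ENNReal.natCast_ne_top _)
  simp [hn, hS.ne_empty]

open Classical in
theorem orbitAverage_real {S : Finset (ℤ → A)} {n : ℕ} {E : Set (ℤ → A)}
    (hE : MeasurableSet E) :
    (orbitAverage S n).real E =
      ((n : ℝ) * S.card)⁻¹ *
        ∑ k ∈ Finset.range n, ((S.filter fun x => translateSeq k x ∈ E).card : ℝ) := by
  have : orbitAverage S n E = ((n * S.card : ℕ) : ENNReal)⁻¹ *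
      ((∑ k ∈ Finset.range n, (S.filter fun x => translateSeq k x ∈ E).card : ℕ) : ENNReal) := by
    simp only [orbitAverage, Measure.smul_apply, Measure.finsetSum_apply, smul_eq_mul,
      Measure.dirac_apply' _ hE, Set.indicator_apply, Pi.one_apply, Finset.sum_boole]
    push_cast
    rfl
  rw [Measure.real, this, ENNReal.toReal_mul, ENNReal.toReal_inv, ENNReal.toReal_natCast,
    ENNReal.toReal_natCast]
  push_cast
  rfl

open Classical in
theorem orbitAverage_real_le {S : Finset (ℤ → A)} (hS : S.Nonempty) {n : ℕ} (hn : n ≠ 0)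
    {E : Set (ℤ → A)} (hE : MeasurableSet E) {b : ℝ}
    (hb : ∀ k < n, ((S.filter fun x => translateSeq k x ∈ E).card : ℝ) ≤ b * S.card) :
    (orbitAverage S n).real E ≤ b := by
  have hS' : (0 : ℝ) < S.card := by exact_mod_cast hS.card_pos
  have hn' : (0 : ℝ) < n := by exact_mod_cast Nat.pos_of_ne_zero hn
  rw [orbitAverage_real hE, inv_mul_le_iff₀ (by positivity)]
  refine (Finset.sum_le_card_nsmul _ _ (b * S.card)
    fun k hk => hb k (Finset.mem_range.1 hk)).trans_eq ?_
  simp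
  ring

open Classical in
theorem le_orbitAverage_real {S : Finset (ℤ → A)} (hS : S.Nonempty) {n : ℕ} (hn : n ≠ 0)
    {E : Set (ℤ → A)} (hE : MeasurableSet E) {b : ℝ}
    (hb : ∀ k < n, b * S.card ≤ ((S.filter fun x => translateSeq k x ∈ E).card : ℝ)) :
    b ≤ (orbitAverage S n).real E := by
  have hS' : (0 : ℝ) < S.card := by exact_mod_cast hS.card_pos
  have hn' : (0 : ℝ) < n := by exact_mod_cast Nat.pos_of_ne_zero hn
  rw [orbitAverage_real hE, le_inv_mul_iff₀ (by positivity)]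
  refine Eq.trans_le ?_ (Finset.card_nsmul_le_sum _ _ (b * S.card)
    fun k hk => hb k (Finset.mem_range.1 hk))
  simp
  ring

theorem integral_orbitAverage [TopologicalSpace A] [OpensMeasurableSpace (ℤ → A)]
    (S : Finset (ℤ → A)) (n : ℕ) (f : BoundedContinuousFunction (ℤ → A) ℝ) :
    ∫ x, f x ∂(orbitAverage S n) =
      ((n : ℝ) * S.card)⁻¹ * ∑ k ∈ Finset.range n, ∑ x ∈ S, f (translateSeq k x) := by
  have hint : ∀ y : ℤ → A, Integrable f (Measure.dirac y) := fun y => f.integrable _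
  rw [orbitAverage, integral_smul_measure, integral_finsetSum_measure
    fun k _ => integrable_finsetSum_measure.2 fun x _ => hint _]
  simp only [integral_finsetSum_measure fun x _ => hint _,
    integral_dirac' _ _ f.continuous.stronglyMeasurable]
  simp

theorem abs_integral_shift_sub_le [TopologicalSpace A] [OpensMeasurableSpace (ℤ → A)]
    {S : Finset (ℤ → A)} (hS : S.Nonempty) {n : ℕ} (hn : n ≠ 0)
    (f : BoundedContinuousFunction (ℤ → A) ℝ) :
    |∫ x, f (shift x) ∂(orbitAverage S n) - ∫ x, f x ∂(orbitAverage S n)| ≤ 2 * ‖f‖ / n := by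
  have hS' : (0 : ℝ) < S.card := by exact_mod_cast hS.card_pos
  have hn' : (0 : ℝ) < n := by exact_mod_cast Nat.pos_of_ne_zero hn
  have h₁ := integral_orbitAverage S n
    (f.compContinuous ⟨shift, continuous_translateSeq 1⟩)
  change ∫ x, f (shift x) ∂(orbitAverage S n) = ((n : ℝ) * S.card)⁻¹ *
    ∑ k ∈ Finset.range n, ∑ x ∈ S, f (shift (translateSeq k x)) at h₁
  have h₂ : ∀ k : ℕ, ∀ x : ℤ → A, shift (translateSeq k x) = translateSeq (k + 1 : ℕ) x := by
    intro k x
    rw [shift_eq_translateSeq, translateSeq_translateSeq]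
    push_cast
    rw [add_comm]
  rw [h₁, integral_orbitAverage, ← mul_sub, ← Finset.sum_sub_distrib]
  simp only [h₂]
  rw [Finset.sum_range_sub (fun k : ℕ => ∑ x ∈ S, f (translateSeq k x)), ← Finset.sum_sub_distrib,
    abs_mul, abs_of_pos (by positivity), inv_mul_le_iff₀ (by positivity)]
  refine (Finset.abs_sum_le_sum_abs _ _).trans ((Finset.sum_le_card_nsmul _ _ (2 * ‖f‖)
    fun x _ => ?_).trans_eq ?_)
  · refine (abs_sub _ _).trans ?_
    have := f.norm_coe_le_norm (translateSeq n x)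
    have := f.norm_coe_le_norm (translateSeq (0 : ℕ) x)
    simp only [Real.norm_eq_abs] at *
    linarith
  · simp
    field_simp

theorem le_orbitAverage_real_of_glue [TopologicalSpace A] {X : Set (ℤ → A)} (hX : IsShiftSpace X) {h C : ℝ}
    (hC : 0 < C) (hup : ∀ n : ℕ, ((langN X n).ncard : ℝ) ≤ C * Real.exp (n * h))
    {G : Set (List A)} {θ : ℝ} (hθ : 0 < θ) {M : ℕ}
    (hGrow : ∀ n : ℕ, ∃ j : ℕ, n - 2 * M ≤ j ∧ j ≤ n ∧
      θ * Real.exp (n * h) ≤ (({w ∈ G | w.length = j}).ncard : ℝ))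
    {T ℓ : ℕ} {E : Set (ℤ → A)} (hE : MeasurableSet E)
    (hEdep : ∀ x y : ℤ → A, (∀ i : ℤ, 0 ≤ i → i < ℓ → x i = y i) → x ∈ E → y ∈ E)
    (hEglue : ∀ a ∈ G, ∀ b ∈ G, ∃ z ∈ X, z ∈ E ∧ OccursAt a z (-((T : ℤ) + a.length)) ∧
      OccursAt b z (ℓ + T))
    {n : ℕ} (hn : n ≠ 0) (hTn : T + ℓ ≤ n) {S : Finset (ℤ → A)}
    (hspan : ∀ x ∈ X, ∃ y ∈ S, wordAt y (-(n : ℤ)) (3 * n) = wordAt x (-(n : ℤ)) (3 * n))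
    (hcard : S.card = (langN X (3 * n)).ncard) (hS : S.Nonempty) :
    θ ^ 2 / C * Real.exp (-(2 * T) * h) * Real.exp (-(ℓ : ℝ) * h) ≤
      (orbitAverage S n).real E := by
  classical
  refine le_orbitAverage_real hS hn hE fun k hk => ?_
  obtain ⟨i, -, hi, hGi⟩ := hGrow (n + k - T)
  obtain ⟨j, -, hj, hGj⟩ := hGrow (2 * n - k - ℓ - T)
  have hcount : ({w ∈ G | w.length = i}).ncard * ({w ∈ G | w.length = j}).ncard ≤
      (S.filter fun x => translateSeq k x ∈ E).card := by
    refine le_card_filter_of_forall_occursAt (fun u hu => hu.2) (fun v hv => hv.2)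
      ((k : ℤ) - T - i) ((k : ℤ) + ℓ + T) ?_
    rintro u ⟨hu, rfl⟩ v ⟨hv, rfl⟩
    obtain ⟨z, hzX, hzE, hzu, hzv⟩ := hEglue u hu v hv
    obtain ⟨y, hyS, hy⟩ := hspan _ (translateSeq_mem hX (-(k : ℤ)) hzX)
    have hagree : ∀ c : ℤ, -(n : ℤ) ≤ c → c < 2 * n → z (c - k) = y c := by
      intro c h₁ h₂
      have := wordAt_eq_iff.1 hy (c + n).toNat (by omega)
      have e : -(n : ℤ) + ((c + n).toNat : ℕ) = c := by omega
      rw [e] at this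
      exact this.symm
    have hoccurs : ∀ (s : List A) (p : ℤ), OccursAt s z (p - k) → -(n : ℤ) ≤ p →
        p + s.length ≤ 2 * n → OccursAt s y p := by
      intro s p hs h₁ h₂ t ht
      rw [← hs t ht, ← hagree _ (by omega) (by omega)]
      congr 1
      ring
    refine ⟨y, hyS, hEdep z _ (fun c h₁ h₂ => ?_) hzE, hoccurs u _ ?_ (by omega) (by omega),
      hoccurs v _ ?_ (by omega) (by omega)⟩
    · rw [translateSeq, ← hagree _ (by omega) (by omega)]
      congr 1
      ring
    · convert hzu using 1
      ring
    · convert hzv using 1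
      ring
  have hlen : ((n + k - T : ℕ) : ℝ) + (2 * n - k - ℓ - T : ℕ) + ℓ + 2 * T = (3 * n : ℕ) := by
    have : (n + k - T) + (2 * n - k - ℓ - T) + ℓ + 2 * T = 3 * n := by omega
    exact_mod_cast this
  calc θ ^ 2 / C * Real.exp (-(2 * T) * h) * Real.exp (-(ℓ : ℝ) * h) * S.card
      ≤ θ ^ 2 / C * Real.exp (-(2 * T) * h) * Real.exp (-(ℓ : ℝ) * h) *
          (C * Real.exp ((3 * n : ℕ) * h)) := by
        rw [hcard]
        exact mul_le_mul_of_nonneg_left (hup _) (by positivity)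
    _ = θ ^ 2 * (Real.exp (-(2 * T) * h) * Real.exp (-(ℓ : ℝ) * h) *
          Real.exp ((3 * n : ℕ) * h)) := by
        field_simp
    _ = (θ * Real.exp ((n + k - T : ℕ) * h)) *
          (θ * Real.exp ((2 * n - k - ℓ - T : ℕ) * h)) := by
        rw [← hlen, mul_mul_mul_comm, ← sq, ← Real.exp_add, ← Real.exp_add, ← Real.exp_add]
        congr 2
        ring
    _ ≤ ({w ∈ G | w.length = i}).ncard * ({w ∈ G | w.length = j}).ncard :=
        mul_le_mul hGi hGj (by positivity) (by positivity)
    _ ≤ _ := by exact_mod_cast hcount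

end Measures

section Entropy

theorem Real.negMulLog_le_mul_log_add {p N : ℝ} (hp : 0 ≤ p) (hN : 0 < N) :
    Real.negMulLog p ≤ p * Real.log N + (N⁻¹ - p) := by
  rcases hp.eq_or_lt with rfl | hp
  · simp [hN.le]
  · have := Real.log_le_sub_one_of_pos (show 0 < (N * p)⁻¹ by positivity)
    rw [Real.log_inv, Real.log_mul hN.ne' hp.ne'] at this
    have h₂ := mul_le_mul_of_nonneg_left this hp.le
    have h₃ : p * ((N * p)⁻¹ - 1) = N⁻¹ - p := by field_simp
    rw [Real.negMulLog]
    linarith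

variable {A : Type*} [Fintype A] [TopologicalSpace A] [DiscreteTopology A] [MeasurableSpace A]
  [BorelSpace A]

theorem sum_measureReal_cylinder (μ : Measure (ℤ → A)) [IsProbabilityMeasure μ] (m : ℕ) :
    ∑ w : Fin m → A, μ.real (_root_.cylinder (List.ofFn w)) = 1 := by
  rw [← measureReal_biUnion_finset]
  · convert probReal_univ (μ := μ) using 2
    refine Set.eq_univ_of_forall fun x => ?_
    simp only [Set.mem_iUnion]
    exact ⟨fun t => x (0 + (t : ℕ)), Finset.mem_univ _, mem_cylinder_ofFn.2 rfl⟩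
  · intro v _ w _ hvw
    refine Set.disjoint_left.2 fun x hv hw => hvw (List.ofFn_injective ?_)
    rw [← mem_cylinder_ofFn.1 hv, mem_cylinder_ofFn.1 hw]
  · exact fun w _ => (isClopen_cylinder _).isOpen.measurableSet

theorem le_cylEntropySum (μ : Measure (ℤ → A)) [IsProbabilityMeasure μ] {m : ℕ} {b : ℝ}
    (hb : ∀ w : List A, w.length = m → μ.real (_root_.cylinder w) ≤ Real.exp (-b)) :
    b ≤ cylEntropySum μ m := by
  rw [← one_mul b, ← sum_measureReal_cylinder μ m, Finset.sum_mul]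
  refine Finset.sum_le_sum fun w _ => ?_
  change _ ≤ Real.negMulLog (μ.real _)
  have hw := hb (List.ofFn w) List.length_ofFn
  have h0 : 0 ≤ μ.real (_root_.cylinder (List.ofFn w)) := measureReal_nonneg
  generalize μ.real (_root_.cylinder (List.ofFn w)) = p at *
  rcases h0.eq_or_lt with rfl | hp
  · simp
  · have := Real.log_le_log hp hw
    rw [Real.log_exp] at this
    rw [Real.negMulLog]
    nlinarith

theorem cylEntropySum_le {X : Set (ℤ → A)} (μ : Measure (ℤ → A)) [IsProbabilityMeasure μ]
    (hμ : μ Xᶜ = 0) {m : ℕ} (hm : 0 < (langN X m).ncard) :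
    cylEntropySum μ m ≤ Real.log (langN X m).ncard := by
  classical
  have hN : (0 : ℝ) < (langN X m).ncard := by exact_mod_cast hm
  have hzero : ∀ w : Fin m → A, List.ofFn w ∉ langN X m →
      μ.real (_root_.cylinder (List.ofFn w)) = 0 := by
    intro w hw
    rw [measureReal_eq_zero_iff]
    refine measure_mono_null (fun x hx => show x ∈ Xᶜ from fun hxX => hw ?_) hμ
    rw [← mem_cylinder_ofFn.1 hx]
    exact wordAt_mem_langN hxX 0 m
  have hcard : (Finset.univ.filter fun w : Fin m → A => List.ofFn w ∈ langN X m).card =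
      (langN X m).ncard := by
    rw [← Set.ncard_coe_finset, ← Set.ncard_image_of_injective _ List.ofFn_injective]
    congr 1
    ext v
    constructor
    · rintro ⟨w, hw, rfl⟩
      simpa using hw
    · intro hv
      refine ⟨fun t => v[(t : ℕ)]'(by rw [hv.2]; exact t.2), ?_, ?_⟩ <;>
        have : List.ofFn (fun t : Fin m => v[(t : ℕ)]'(by rw [hv.2]; exact t.2)) = v :=
          List.ext_getElem (by simp [hv.2]) (by simp)
      · simpa [this] using hv
      · exact this
  calc cylEntropySum μ m
      ≤ ∑ w : Fin m → A, (μ.real (_root_.cylinder (List.ofFn w)) * Real.log (langN X m).ncard +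
          ((if List.ofFn w ∈ langN X m then ((langN X m).ncard : ℝ)⁻¹ else 0) -
            μ.real (_root_.cylinder (List.ofFn w)))) := by
        refine Finset.sum_le_sum fun w _ => ?_
        change Real.negMulLog (μ.real _) ≤ _
        split_ifs with hw
        · exact Real.negMulLog_le_mul_log_add measureReal_nonneg hN
        · simp [hzero w hw]
    _ = Real.log (langN X m).ncard := by
        rw [Finset.sum_add_distrib, Finset.sum_sub_distrib, ← Finset.sum_mul,
          sum_measureReal_cylinder, Finset.sum_ite, Finset.sum_const, hcard]
        simp [hN.ne']

end Entropy

section Bounds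

variable {A : Type*} [Fintype A] [TopologicalSpace A] [DiscreteTopology A] [MeasurableSpace A]
  [BorelSpace A]

theorem orbitAverage_real_cylinder_le {X : Set (ℤ → A)} {h C : ℝ}
    (hlow : ∀ n : ℕ, 1 ≤ n → Real.exp (n * h) ≤ (langN X n).ncard)
    (hup : ∀ n : ℕ, ((langN X n).ncard : ℝ) ≤ C * Real.exp (n * h))
    {n : ℕ} (hn : n ≠ 0) {S : Finset (ℤ → A)} (hSX : ∀ x ∈ S, x ∈ X)
    (hinj : Set.InjOn (fun x => wordAt x (-(n : ℤ)) (3 * n)) (S : Set (ℤ → A)))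
    (hcard : S.card = (langN X (3 * n)).ncard) (hS : S.Nonempty) {w : List A}
    (hw : w.length ≤ n) :
    (orbitAverage S n).real (_root_.cylinder w) ≤ C ^ 2 * Real.exp (-(w.length : ℝ) * h) := by
  classical
  refine orbitAverage_real_le hS hn (isClopen_cylinder w).isOpen.measurableSet fun k hk => ?_
  have hlen : n + k + w.length + (2 * n - k - w.length) = 3 * n := by omega
  have hcount := card_filter_occursAt_le hSX (-(n : ℤ)) (n + k) (2 * n - k - w.length) w
    (by rwa [hlen])
  have hfilter : (S.filter fun x => translateSeq k x ∈ _root_.cylinder w) =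
      S.filter fun x => OccursAt w x (-(n : ℤ) + (n + k : ℕ)) := by
    refine Finset.filter_congr fun x _ => ?_
    rw [mem_cylinder_iff_occursAt, occursAt_translateSeq]
    push_cast
    simp
  rw [hfilter]
  have hlen' : ((n + k : ℕ) : ℝ) + (2 * n - k - w.length : ℕ) = (3 * n : ℕ) - w.length := by
    rw [← hlen]
    push_cast
    ring
  calc (((S.filter fun x => OccursAt w x (-(n : ℤ) + (n + k : ℕ))).card : ℕ) : ℝ)
      ≤ (langN X (n + k)).ncard * (langN X (2 * n - k - w.length)).ncard := by
        exact_mod_cast hcount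
    _ ≤ (C * Real.exp ((n + k : ℕ) * h)) *
          (C * Real.exp ((2 * n - k - w.length : ℕ) * h)) :=
        mul_le_mul (hup _) (hup _) (by positivity) ((Nat.cast_nonneg _).trans (hup _))
    _ = C ^ 2 * Real.exp (-(w.length : ℝ) * h) * Real.exp ((3 * n : ℕ) * h) := by
        rw [mul_mul_mul_comm, ← Real.exp_add, ← add_mul, hlen', mul_assoc (C ^ 2),
          ← Real.exp_add, sq]
        congr 2
        ring
    _ ≤ C ^ 2 * Real.exp (-(w.length : ℝ) * h) * S.card := by
        rw [hcard]
        exact mul_le_mul_of_nonneg_left (hlow _ (by omega)) (by positivity)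

theorem isShiftInvariant_of_tendsto {μ : ProbabilityMeasure (ℤ → A)}
    {μs : ℕ → ProbabilityMeasure (ℤ → A)} {L : Filter ℕ} [L.NeBot]
    (hL : L ≤ atTop) (hμ : Tendsto μs L (nhds μ)) {S : ℕ → Finset (ℤ → A)}
    (hS : ∀ n, (S n).Nonempty)
    (hμs : ∀ n, (μs n : Measure (ℤ → A)) = orbitAverage (S n) (n + 1)) :
    IsShiftInvariant (μ : Measure (ℤ → A)) := by
  have hcont : Continuous (shift : (ℤ → A) → ℤ → A) := continuous_translateSeq 1
  have hmap : (μ : Measure (ℤ → A)).map shift = μ := by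
    have := Measure.isProbabilityMeasure_map (μ := (μ : Measure (ℤ → A)))
      hcont.measurable.aemeasurable
    refine ext_of_forall_integral_eq_of_IsFiniteMeasure fun f => ?_
    rw [integral_map hcont.measurable.aemeasurable f.continuous.aestronglyMeasurable,
      ← sub_eq_zero]
    have hlim := ProbabilityMeasure.tendsto_iff_forall_integral_tendsto.1 hμ
    have h₁ := (hlim (f.compContinuous ⟨shift, hcont⟩)).sub (hlim f)
    refine tendsto_nhds_unique h₁ (squeeze_zero_norm (fun n => ?_)
      ((tendsto_const_div_atTop_nhds_zero_nat (2 * ‖f‖)).comp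
        ((tendsto_add_atTop_nat 1).mono_left hL)))
    rw [hμs]
    exact abs_integral_shift_sub_le (hS n) n.succ_ne_zero f
  intro E hE
  rw [← Measure.map_apply hcont.measurable hE, hmap]

end Bounds

/-- Existence of an MME with a Gibbs-type lower bound on cylinders of good words. -/
theorem exists_gibbs_mme {A : Type*} [Fintype A]
    [TopologicalSpace A] [DiscreteTopology A] [MeasurableSpace A] [BorelSpace A]
    (X : Set (ℤ → A)) (hX : IsShiftSpace X) (h : ℝ)
    (hEnt : Tendsto (fun n : ℕ => Real.log ((langN X n).ncard) / n) atTop (nhds h))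
    (C₂ : ℝ)
    (hbounds : ∀ n : ℕ, 1 ≤ n →
      Real.exp (n * h) ≤ ((langN X n).ncard : ℝ) ∧
      ((langN X n).ncard : ℝ) ≤ C₂ * Real.exp (n * h))
    (G : Set (List A)) (hG : G ⊆ language X)
    -- (III) variable-length specification
    (T : ℕ)
    (hIII : ∀ u v w x : List A, u ∈ G → v ∈ G → w ∈ G → x ∈ G →
      ∃ p ∈ langN X T, ∃ q ∈ langN X T, ∃ r ∈ langN X T,
        u ++ p ++ v ++ q ++ w ++ r ++ x ∈ language X)
    -- lower bound on the number of good words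
    (θ : ℝ) (hθ : 0 < θ) (M : ℕ)
    (hGrow : ∀ n : ℕ, ∃ j : ℕ, n - 2 * M ≤ j ∧ j ≤ n ∧
      θ * Real.exp (n * h) ≤ (({w ∈ G | w.length = j}).ncard : ℝ)) :
    ∃ μ : Measure (ℤ → A), IsMME X h μ ∧ ∃ c : ℝ, 0 < c ∧
      (∀ w ∈ G, ENNReal.ofReal (c * Real.exp (-(w.length : ℝ) * h)) ≤ μ (cylinder w)) ∧
      (∀ u ∈ G, ∀ v ∈ G,
        ENNReal.ofReal (c * Real.exp (-((u.length : ℝ) + (v.length : ℝ)) * h)) ≤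
          μ (cylinder u ∩ (shift^[u.length + T]) ⁻¹' cylinder v)) := by
  have hC : 1 ≤ C₂ := by
    have := (hbounds 1 le_rfl).1.trans (hbounds 1 le_rfl).2
    exact (le_mul_iff_one_le_left (Real.exp_pos _)).1 this
  have hC0 : 0 < C₂ := one_pos.trans_le hC
  have hXne : X.Nonempty := by
    by_contra hX'
    have : langN X 1 = ∅ := by
      rw [← image_wordAt hX 0 1, Set.not_nonempty_iff_eq_empty.1 hX', Set.image_empty]
    have h₁ := (hbounds 1 le_rfl).1
    rw [this, Set.ncard_empty, Nat.cast_zero] at h₁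
    exact absurd h₁ (not_le.2 (Real.exp_pos _))
  have hpos : ∀ m : ℕ, 0 < (langN X m).ncard := fun m => by
    rw [Set.ncard_pos (finite_langN X m), ← image_wordAt hX 0 m]
    exact hXne.image _
  have hup : ∀ n : ℕ, ((langN X n).ncard : ℝ) ≤ C₂ * Real.exp (n * h) := by
    intro n
    rcases Nat.eq_zero_or_pos n with rfl | hn
    · have : (langN X 0).ncard ≤ 1 := by
        rw [← Set.ncard_singleton ([] : List A)]
        exact Set.ncard_le_ncard (fun w hw => List.length_eq_zero_iff.1 hw.2)
      have : ((langN X 0).ncard : ℝ) ≤ 1 := by exact_mod_cast this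
      simpa using this.trans hC
    · exact (hbounds n hn).2
  choose S hSX hinj hcard hspan using fun n : ℕ =>
    exists_separated_spanning hX (-((n + 1 : ℕ) : ℤ)) (3 * (n + 1))
  have hS : ∀ n, (S n).Nonempty := fun n => Finset.card_pos.1 (by rw [hcard]; exact hpos _)
  let μs : ℕ → ProbabilityMeasure (ℤ → A) := fun n =>
    ⟨orbitAverage (S n) (n + 1), isProbabilityMeasure_orbitAverage (hS n) n.succ_ne_zero⟩
  let L : Ultrafilter ℕ := Ultrafilter.of atTop
  have hL : (L : Filter ℕ) ≤ atTop := Ultrafilter.of_le atTop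
  obtain ⟨μ, hμ⟩ : ∃ μ, Tendsto μs L (nhds μ) := ⟨_, (L.map μs).le_nhds_lim⟩
  have hclopen : ∀ E : Set (ℤ → A), IsClopen E →
      Tendsto (fun n => (orbitAverage (S n) (n + 1)).real E) L
        (nhds ((μ : Measure (ℤ → A)).real E)) := fun E hE =>
    (NNReal.tendsto_coe.2 (ProbabilityMeasure.tendsto_measure_of_isClopen_of_tendsto hμ hE))
  have hlarge : ∀ k : ℕ, ∀ᶠ n in (L : Filter ℕ), k ≤ n + 1 := fun k =>
    hL ((eventually_ge_atTop k).mono fun n hn => hn.trans n.le_succ)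
  have hupper : ∀ w : List A, (μ : Measure (ℤ → A)).real (_root_.cylinder w) ≤
      C₂ ^ 2 * Real.exp (-(w.length : ℝ) * h) := fun w =>
    le_of_tendsto (hclopen _ (isClopen_cylinder w)) ((hlarge w.length).mono fun n hn =>
      orbitAverage_real_cylinder_le (fun k hk => (hbounds k hk).1) hup n.succ_ne_zero
        (hSX n) (hinj n) (hcard n) (hS n) hn)
  set c₀ : ℝ := θ ^ 2 / C₂ * Real.exp (-(2 * T) * h) with hc₀
  have hc₀pos : 0 < c₀ := by positivity
  have hlower : ∀ (ℓ : ℕ) (E : Set (ℤ → A)), IsClopen E →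
      (∀ x y : ℤ → A, (∀ i : ℤ, 0 ≤ i → i < ℓ → x i = y i) → x ∈ E → y ∈ E) →
      (∀ a ∈ G, ∀ b ∈ G, ∃ z ∈ X, z ∈ E ∧ OccursAt a z (-((T : ℤ) + a.length)) ∧
        OccursAt b z (ℓ + T)) →
      c₀ * Real.exp (-(ℓ : ℝ) * h) ≤ (μ : Measure (ℤ → A)).real E :=
    fun ℓ E hE hdep hglue => ge_of_tendsto (hclopen E hE) ((hlarge (T + ℓ)).mono fun n hn =>
      le_orbitAverage_real_of_glue hX hC0 hup hθ hGrow hE.isOpen.measurableSet hdep hglue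
        n.succ_ne_zero hn (hspan n) (hcard n) (hS n))
  have hcompl : (μ : Measure (ℤ → A)) Xᶜ = 0 := by
    have hzero : ∀ n, (μs n : Measure (ℤ → A)) Xᶜ = 0 := by
      intro n
      rw [← measureReal_eq_zero_iff]
      refine le_antisymm (orbitAverage_real_le (hS n) n.succ_ne_zero
        hX.1.isOpen_compl.measurableSet fun k _ => ?_) measureReal_nonneg
      rw [zero_mul, Nat.cast_nonpos, Finset.card_eq_zero]
      refine Finset.eq_empty_of_forall_notMem fun x hx => ?_
      simp only [Finset.mem_filter] at hx
      exact hx.2 (translateSeq_mem hX _ (hSX n x hx.1))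
    have := ProbabilityMeasure.le_liminf_measure_open_of_tendsto hμ hX.1.isOpen_compl
    simpa [hzero] using this
  refine ⟨μ, ⟨inferInstance, ?_, isShiftInvariant_of_tendsto hL hμ hS fun _ => rfl, ?_⟩,
    min c₀ (c₀ * Real.exp (-(T : ℝ) * h)), by positivity, ?_, ?_⟩
  · exact (prob_compl_eq_zero_iff hX.1.measurableSet).1 hcompl
  · have hlim : Tendsto (fun m : ℕ => (m * h - Real.log (C₂ ^ 2)) / m) atTop (nhds h) := by
      have h₁ : Tendsto (fun m : ℕ => h - Real.log (C₂ ^ 2) / m) atTop (nhds (h - 0)) :=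
        tendsto_const_nhds.sub (tendsto_const_div_atTop_nhds_zero_nat _)
      rw [sub_zero] at h₁
      refine h₁.congr' ((eventually_gt_atTop 0).mono fun m hm => ?_)
      have : (m : ℝ) ≠ 0 := by exact_mod_cast hm.ne'
      field_simp
    refine tendsto_of_tendsto_of_tendsto_of_le_of_le hlim hEnt (fun m => ?_) (fun m => ?_)
    · refine div_le_div_of_nonneg_right (le_cylEntropySum _ fun w hw => ?_) m.cast_nonneg
      refine (hupper w).trans_eq ?_
      rw [neg_sub, Real.exp_sub, Real.exp_log (by positivity), hw, neg_mul, Real.exp_neg,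
        div_eq_mul_inv]
    · exact div_le_div_of_nonneg_right (cylEntropySum_le _ hcompl (hpos m)) m.cast_nonneg
  · intro w hw
    rw [ENNReal.ofReal_le_iff_le_toReal (measure_ne_top _ _)]
    refine (mul_le_mul_of_nonneg_right (min_le_left _ _) (Real.exp_pos _).le).trans
      (hlower w.length _ (isClopen_cylinder w) (fun x y hxy hx => ?_) fun a ha b hb => ?_)
    · rw [mem_cylinder_iff_occursAt] at hx ⊢
      exact hx.congr fun j h₁ h₂ => hxy j h₁ (by simpa using h₂)
    · obtain ⟨p, hp, q, hq, r, -, hlang⟩ := hIII a w b b ha hw hb hb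
      obtain ⟨z, hz, hocc⟩ := exists_occursAt hX hlang (-((T : ℤ) + a.length))
      simp only [occursAt_append, List.length_append, hp.2, hq.2] at hocc
      obtain ⟨⟨⟨⟨⟨⟨haz, -⟩, hwz⟩, -⟩, hbz⟩, -⟩, -⟩ := hocc
      refine ⟨z, hz, mem_cylinder_iff_occursAt.2 ?_, haz, ?_⟩
      · convert hwz using 1
        push_cast
        ring
      · convert hbz using 1
        push_cast
        ring
  · intro u hu v hv
    have hset : _root_.cylinder u ∩ shift^[u.length + T] ⁻¹' _root_.cylinder v =
        {x | OccursAt u x 0} ∩ {x | OccursAt v x (u.length + T : ℕ)} := by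
      ext x
      simp only [Set.mem_inter_iff, Set.mem_preimage, Set.mem_ofPred_eq,
        mem_cylinder_iff_occursAt, iterate_shift, occursAt_translateSeq, zero_add]
    rw [ENNReal.ofReal_le_iff_le_toReal (measure_ne_top _ _), hset]
    refine le_trans ?_ (hlower (u.length + T + v.length) _
      ((isClopen_setOf_occursAt u _).inter (isClopen_setOf_occursAt v _))
      (fun x y hxy hx => ?_) fun a ha b hb => ?_)
    · refine (mul_le_mul_of_nonneg_right (min_le_right _ _) (Real.exp_pos _).le).trans_eq ?_
      rw [mul_assoc, ← Real.exp_add]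
      congr 2
      push_cast
      ring
    · exact ⟨hx.1.congr fun j h₁ h₂ => hxy j h₁ (by push_cast; omega),
        hx.2.congr fun j h₁ h₂ => hxy j (by omega) (by push_cast at *; omega)⟩
    · obtain ⟨p, hp, q, hq, r, hr, hlang⟩ := hIII a u v b ha hu hv hb
      obtain ⟨z, hz, hocc⟩ := exists_occursAt hX hlang (-((T : ℤ) + a.length))
      simp only [occursAt_append, List.length_append, hp.2, hq.2, hr.2] at hocc
      obtain ⟨⟨⟨⟨⟨⟨haz, -⟩, huz⟩, -⟩, hvz⟩, -⟩, hbz⟩ := hocc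
      refine ⟨z, hz, ⟨?_, ?_⟩, haz, ?_⟩
      · change OccursAt u z 0
        convert huz using 1
        push_cast
        ring
      · change OccursAt v z _
        convert hvz using 1
        push_cast
        ring
      · convert hbz using 1
        push_cast
        ring
end

section
/- Let X be a shift space on a finite alphabet with language L and topological entropy h, and suppose C^p, G, C^s ⊆ L satisfy: (I) every w ∈ L can be written w = u^p v u^s with u^p ∈ C^p, v ∈ G, u^s ∈ C^s; (II') Q := (Σ_{i≥0} #C^p_i e^{−ih})(Σ_{k≥0} #C^s_k e^{−kh}) < ∞; and there exists C₁ > 0 with #G_j ≤ C₁ e^{jh} for all j. Then for every α ∈ (0,1) there exist M ∈ ℕ and θ ∈ (0,1) such that for every n > 2M and every D ⊆ L_n with #D ≥ α e^{nh}, there exist i, k ∈ {0, 1, …, M} with #(φ_{i,k}(D) ∩ G) ≥ θ e^{nh}. -/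
open MeasureTheory Filter Real Set

/-- Deleting a prefix and a suffix from a concatenation leaves the middle word. -/
lemma phi_append {A : Type*} (u v s : List A) :
    phi u.length s.length (u ++ v ++ s) = v := by
  have h : (u ++ v ++ s).length - u.length - s.length = v.length := by
    simp only [List.length_append]; omega
  rw [phi, h]
  simp

lemma length_phi {A : Type*} {i k : ℕ} (w : List A) :
    (phi i k w).length = w.length - i - k := by
  simp only [phi, List.length_take, List.length_drop]
  omega

lemma finite_setOf_mem_length_eq {A : Type*} [Finite A] (S : Set (List A)) (i : ℕ) :
    {w ∈ S | w.length = i}.Finite :=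
  (List.finite_length_eq A i).subset fun _ hw => hw.2

/-- The number of words of `D` is controlled by the number of triples (prefix, core, suffix),
summed over the possible lengths of prefix and suffix. -/
lemma ncard_le_sum_of_decomposition {A : Type*} [Finite A] {Cp G Cs D : Set (List A)} {n : ℕ}
    (hlen : ∀ w ∈ D, w.length = n)
    (hdec : ∀ w ∈ D, ∃ up ∈ Cp, ∃ v ∈ G, ∃ us ∈ Cs, w = up ++ v ++ us) :
    D.ncard ≤ ∑ p ∈ (Finset.range (n + 1) ×ˢ Finset.range (n + 1)).filter
        (fun p => p.1 + p.2 ≤ n),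
      {w ∈ Cp | w.length = p.1}.ncard *
        ((phi p.1 p.2 '' D ∩ G).ncard * {w ∈ Cs | w.length = p.2}.ncard) := by
  have hD : D.Finite := (List.finite_length_eq A n).subset hlen
  set P := (Finset.range (n + 1) ×ˢ Finset.range (n + 1)).filter (fun p => p.1 + p.2 ≤ n)
  let T : ℕ × ℕ → Set (List A × List A × List A) := fun p =>
    {w ∈ Cp | w.length = p.1} ×ˢ ((phi p.1 p.2 '' D ∩ G) ×ˢ {w ∈ Cs | w.length = p.2})
  let f : List A × List A × List A → List A := fun t => t.1 ++ t.2.1 ++ t.2.2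
  have hT : ∀ p, (T p).Finite := fun p =>
    (finite_setOf_mem_length_eq _ _).prod
      (((hD.image _).inter_of_left _).prod (finite_setOf_mem_length_eq _ _))
  have hsub : D ⊆ ⋃ p ∈ P, f '' T p := by
    intro w hw
    obtain ⟨u, hu, v, hv, s, hs, rfl⟩ := hdec w hw
    have hl := hlen _ hw
    simp only [List.length_append] at hl
    simp only [Set.mem_iUnion]
    refine ⟨(u.length, s.length), ?_, (u, v, s), ⟨⟨hu, rfl⟩, ⟨⟨_, hw, phi_append u v s⟩, hv⟩,
      ⟨hs, rfl⟩⟩, rfl⟩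
    simp only [P, Finset.mem_filter, Finset.mem_product, Finset.mem_range]
    omega
  calc D.ncard ≤ (⋃ p ∈ P, f '' T p).ncard :=
        Set.ncard_le_ncard hsub (P.finite_toSet.biUnion fun p _ => (hT p).image f)
    _ ≤ ∑ p ∈ P, (f '' T p).ncard := Finset.set_ncard_biUnion_le _ _
    _ ≤ ∑ p ∈ P, (T p).ncard := Finset.sum_le_sum fun p _ => Set.ncard_image_le (hT p)
    _ = _ := Finset.sum_congr rfl fun p _ => by rw [Set.ncard_prod, Set.ncard_prod]

/-- A summable family on `ℕ × ℕ` has small sums outside a large enough square. -/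
lemma Summable.exists_square_tail_lt {f : ℕ × ℕ → ℝ} (hf : Summable f) {ε : ℝ} (hε : 0 < ε) :
    ∃ M : ℕ, ∀ t : Finset (ℕ × ℕ), (∀ p ∈ t, ¬ (p.1 ≤ M ∧ p.2 ≤ M)) → ∑ p ∈ t, f p < ε := by
  obtain ⟨s, hs⟩ := summable_iff_vanishing_norm.1 hf ε hε
  refine ⟨s.sup fun p => max p.1 p.2, fun t ht => (le_abs_self _).trans_lt (hs t ?_)⟩
  refine Finset.disjoint_left.2 fun p hpt hps => ht p hpt ?_
  exact max_le_iff.1 (Finset.le_sup (f := fun p : ℕ × ℕ => max p.1 p.2) hps)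

lemma exp_sub_sub_mul {n i k : ℕ} (hik : i + k ≤ n) (h : ℝ) :
    Real.exp ((n - i - k : ℕ) * h) =
      Real.exp (n * h) * Real.exp (-(i : ℝ) * h) * Real.exp (-(k : ℝ) * h) := by
  rw [← Real.exp_add, ← Real.exp_add, Nat.sub_sub, Nat.cast_sub hik]
  push_cast
  ring_nf

/-- If the sums `∑ aᵢ e^{-ih}` and `∑ bₖ e^{-kh}` converge and `N (i, k)` is at most a constant
times `e^{(n-i-k)h}`, then a sum `∑ aᵢ N (i, k) bₖ` over `i + k ≤ n` of size at least `α e^{nh}`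
forces some `N (i, k)` with `i` and `k` bounded to be at least a constant times `e^{nh}`. -/
lemma exists_le_of_le_weighted_sum {a b : ℕ → ℝ} {h C α : ℝ}
    (ha : ∀ i, 0 ≤ a i) (hb : ∀ k, 0 ≤ b k)
    (hSuma : Summable fun i : ℕ => a i * Real.exp (-(i : ℝ) * h))
    (hSumb : Summable fun k : ℕ => b k * Real.exp (-(k : ℝ) * h))
    (hC : 0 < C) (hα : 0 < α) (hα1 : α < 1) :
    ∃ M : ℕ, ∃ θ : ℝ, 0 < θ ∧ θ < 1 ∧
      ∀ (n : ℕ) (N : ℕ × ℕ → ℝ) (P : Finset (ℕ × ℕ)),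
        (∀ p ∈ P, p.1 + p.2 ≤ n) →
        (∀ p ∈ P, N p ≤ C * Real.exp ((n - p.1 - p.2 : ℕ) * h)) →
        α * Real.exp (n * h) ≤ ∑ p ∈ P, a p.1 * (N p * b p.2) →
        ∃ i k : ℕ, i ≤ M ∧ k ≤ M ∧ θ * Real.exp (n * h) ≤ N (i, k) := by
  have hf := hSuma.mul_of_nonneg hSumb (fun i => mul_nonneg (ha i) (Real.exp_pos _).le)
    (fun k => mul_nonneg (hb k) (Real.exp_pos _).le)
  obtain ⟨M, hM⟩ := hf.exists_square_tail_lt (ε := α / (2 * C)) (by positivity)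
  let S := Finset.range (M + 1) ×ˢ Finset.range (M + 1)
  obtain ⟨K, hKS⟩ : ∃ K : ℝ, ∑ p ∈ S, a p.1 * b p.2 = K := ⟨_, rfl⟩
  have hK : 0 ≤ K := hKS ▸ Finset.sum_nonneg fun p _ => mul_nonneg (ha _) (hb _)
  refine ⟨M, α / (2 * (K + 1)), by positivity, ?_, ?_⟩
  · rw [div_lt_one (by positivity)]
    linarith
  intro n N P hP hN hle
  obtain ⟨θ, hθ⟩ : ∃ θ : ℝ, α / (2 * (K + 1)) = θ := ⟨_, rfl⟩
  rw [hθ]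
  by_contra! hcon
  have hθ0 : 0 < θ := by rw [← hθ]; positivity
  obtain ⟨E, hEn⟩ : ∃ E : ℝ, Real.exp (n * h) = E := ⟨_, rfl⟩
  have hE : 0 < E := hEn ▸ Real.exp_pos _
  rw [hEn] at hle hcon
  rw [← Finset.sum_filter_add_sum_filter_not P (fun p => p.1 ≤ M ∧ p.2 ≤ M)] at hle
  have hgood : ∑ p ∈ P with p.1 ≤ M ∧ p.2 ≤ M, a p.1 * (N p * b p.2) ≤ θ * E * K := by
    calc _ ≤ ∑ p ∈ P with p.1 ≤ M ∧ p.2 ≤ M, θ * E * (a p.1 * b p.2) := by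
          refine Finset.sum_le_sum fun p hp => ?_
          obtain ⟨-, h1, h2⟩ := Finset.mem_filter.1 hp
          rw [mul_left_comm]
          exact mul_le_mul_of_nonneg_right (hcon p.1 p.2 h1 h2).le
            (mul_nonneg (ha p.1) (hb p.2))
      _ ≤ ∑ p ∈ S, θ * E * (a p.1 * b p.2) := by
          refine Finset.sum_le_sum_of_subset_of_nonneg ?_ fun p _ _ =>
            mul_nonneg (by positivity) (mul_nonneg (ha _) (hb _))
          intro p hp
          obtain ⟨-, h1, h2⟩ := Finset.mem_filter.1 hp
          simp only [S, Finset.mem_product, Finset.mem_range]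
          omega
      _ = _ := by rw [← Finset.mul_sum, hKS]
  have hbad : ∑ p ∈ P with ¬ (p.1 ≤ M ∧ p.2 ≤ M), a p.1 * (N p * b p.2) ≤
      C * E * (α / (2 * C)) := by
    refine le_trans ?_ (mul_le_mul_of_nonneg_left
      (hM {p ∈ P | ¬ (p.1 ≤ M ∧ p.2 ≤ M)} fun p hp => (Finset.mem_filter.1 hp).2).le
      (by positivity))
    rw [Finset.mul_sum]
    refine Finset.sum_le_sum fun p hp => ?_
    have hpP := (Finset.mem_filter.1 hp).1
    have hNp := hN p hpP
    rw [exp_sub_sub_mul (hP p hpP), hEn] at hNp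
    have := mul_le_mul_of_nonneg_right hNp (mul_nonneg (ha p.1) (hb p.2))
    linarith only [this]
  have hhalf : C * E * (α / (2 * C)) = α / 2 * E := by
    field_simp
  have hθK : θ * K * E < α / 2 * E := by
    refine mul_lt_mul_of_pos_right ?_ hE
    have : θ * (K + 1) = α / 2 := by
      rw [← hθ]
      field_simp
    linarith only [this, hθ0]
  linarith only [hle, hgood, hbad, hhalf, hθK]

/-- Large collections of words contain, after trimming at most `M` symbols from
each end, many good words. -/
theorem trimmed_good_words_lower_bound {A : Type*} [Fintype A]
    [TopologicalSpace A] [DiscreteTopology A]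
    (X : Set (ℤ → A)) (hX : IsShiftSpace X) (h : ℝ)
    (hEnt : Tendsto (fun n : ℕ => Real.log ((langN X n).ncard) / n) atTop (nhds h))
    (Cp G Cs : Set (List A))
    (hCp : Cp ⊆ language X) (hG : G ⊆ language X) (hCs : Cs ⊆ language X)
    (hI : ∀ w ∈ language X, ∃ up ∈ Cp, ∃ v ∈ G, ∃ us ∈ Cs, w = up ++ v ++ us)
    (hSump : Summable fun i : ℕ =>
      (({w ∈ Cp | w.length = i}).ncard : ℝ) * Real.exp (-(i : ℝ) * h))
    (hSums : Summable fun k : ℕ =>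
      (({w ∈ Cs | w.length = k}).ncard : ℝ) * Real.exp (-(k : ℝ) * h))
    (C₁ : ℝ) (hC₁ : 0 < C₁)
    (hGle : ∀ j : ℕ, (({w ∈ G | w.length = j}).ncard : ℝ) ≤ C₁ * Real.exp (j * h)) :
    ∀ α : ℝ, 0 < α → α < 1 →
      ∃ M : ℕ, ∃ θ : ℝ, 0 < θ ∧ θ < 1 ∧
        ∀ n : ℕ, 2 * M < n → ∀ D : Set (List A), D ⊆ langN X n →
          α * Real.exp (n * h) ≤ (D.ncard : ℝ) →
          ∃ i k : ℕ, i ≤ M ∧ k ≤ M ∧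
            θ * Real.exp (n * h) ≤ (((phi i k '' D) ∩ G).ncard : ℝ) := by
  intro α hα hα1
  obtain ⟨M, θ, hθ0, hθ1, hMθ⟩ := exists_le_of_le_weighted_sum (fun i => Nat.cast_nonneg _)
    (fun k => Nat.cast_nonneg _) hSump hSums hC₁ hα hα1
  refine ⟨M, θ, hθ0, hθ1, fun n _ D hD hcard => ?_⟩
  have hle := (Nat.cast_le (α := ℝ)).2 (ncard_le_sum_of_decomposition (fun w hw => (hD hw).2)
    fun w hw => hI w (hD hw).1)
  push_cast at hle
  refine hMθ n (fun p => ((phi p.1 p.2 '' D ∩ G).ncard : ℝ)) _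
    (fun p hp => (Finset.mem_filter.1 hp).2) (fun p _ => ?_) (hcard.trans hle)
  refine le_trans ?_ (hGle (n - p.1 - p.2))
  refine Nat.cast_le.2 (Set.ncard_le_ncard ?_ (finite_setOf_mem_length_eq _ _))
  rintro _ ⟨⟨w, hw, rfl⟩, hwG⟩
  exact ⟨hwG, by rw [length_phi, (hD hw).2]⟩
end

section
/- Let X be a shift space on a finite alphabet with language L, and let ν₁, ν₂ be mutually singular invariant Borel probability measures on X. Then for every ζ > 0 there exist collections U_n ⊆ L_n (for each n ∈ ℕ) and n₀ ∈ ℕ such that: (1) ν₁([U_n]) ≥ 1 − ζ for all n; and (2) ν₂([φ_{i,j}(U_n)]) ≤ ζ for all i, j, n satisfying n ≥ 2(n₀ + max(i,j)). -/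
open MeasureTheory Filter Real Set

theorem shift_iterate_apply {A : Type*} (c : ℕ) (x : ℤ → A) (k : ℤ) :
    shift^[c] x k = x (k + c) := by
  induction c generalizing x with
  | zero => simp
  | succ c ih =>
    rw [Function.iterate_succ_apply, ih]
    simp only [shift]
    congr 1
    push_cast
    ring

theorem measurable_shift {A : Type*} [MeasurableSpace A] :
    Measurable (shift : (ℤ → A) → ℤ → A) :=
  measurable_pi_lambda _ fun n => measurable_pi_apply (n + 1)

theorem IsShiftInvariant.measure_preimage_iterate {A : Type*} [MeasurableSpace A]
    {μ : Measure (ℤ → A)} (h : IsShiftInvariant μ) {E : Set (ℤ → A)} (hE : MeasurableSet E)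
    (c : ℕ) : μ (shift^[c] ⁻¹' E) = μ E := by
  induction c with
  | zero => simp
  | succ c ih =>
    rw [Function.iterate_succ, Set.preimage_comp, h _ (measurable_shift.iterate c hE), ih]

/-- The points all of whose modifications outside the window `[-m, m)` stay in `O`. -/
def windowInterior {A : Type*} (O : Set (ℤ → A)) (m : ℕ) : Set (ℤ → A) :=
  {x | ∀ y : ℤ → A, (∀ k : ℤ, -m ≤ k → k < m → x k = y k) → y ∈ O}

theorem windowInterior_subset {A : Type*} (O : Set (ℤ → A)) (m : ℕ) :
    windowInterior O m ⊆ O := fun x hx => hx x fun _ _ _ => rfl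

theorem mem_windowInterior_of_agree {A : Type*} {O : Set (ℤ → A)} {m : ℕ} {x y : ℤ → A}
    (hx : x ∈ windowInterior O m) (hxy : ∀ k : ℤ, -m ≤ k → k < m → x k = y k) :
    y ∈ windowInterior O m :=
  fun z hz => hx z fun k h₁ h₂ => (hxy k h₁ h₂).trans (hz k h₁ h₂)

theorem monotone_windowInterior {A : Type*} (O : Set (ℤ → A)) :
    Monotone (windowInterior O) := by
  intro m m' h x hx y hy
  exact hx y fun k h₁ h₂ => hy k (by omega) (by omega)

theorem isOpen_windowInterior {A : Type*} [TopologicalSpace A] [DiscreteTopology A]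
    (O : Set (ℤ → A)) (m : ℕ) : IsOpen (windowInterior O m) := by
  rw [isOpen_iff_mem_nhds]
  intro x hx
  have hU : (Set.Ico (-(m : ℤ)) m).pi (fun k => {x k}) ∈ nhds x :=
    set_pi_mem_nhds (Set.finite_Ico _ _) fun k _ => (isOpen_discrete {x k}).mem_nhds rfl
  filter_upwards [hU] with y hy
  exact mem_windowInterior_of_agree hx fun k h₁ h₂ => (hy k ⟨h₁, h₂⟩).symm

theorem iUnion_windowInterior {A : Type*} [TopologicalSpace A] {O : Set (ℤ → A)}
    (hO : IsOpen O) : ⋃ m, windowInterior O m = O := by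
  refine Set.Subset.antisymm (Set.iUnion_subset (windowInterior_subset O)) fun x hx => ?_
  obtain ⟨I, u, hu, hsub⟩ := isOpen_pi_iff.1 hO x hx
  refine Set.mem_iUnion.2 ⟨I.sup Int.natAbs + 1, fun y hy => hsub fun k hk => ?_⟩
  have hle : k.natAbs ≤ I.sup Int.natAbs := Finset.le_sup (f := Int.natAbs) hk
  rw [← hy k (by omega) (by omega)]
  exact (hu k hk).2

/-- Mutually singular measures are almost separated by an open set depending on finitely many
coordinates. -/
theorem exists_windowInterior_separating {A : Type*} [Fintype A]
    [TopologicalSpace A] [DiscreteTopology A] [MeasurableSpace A] [BorelSpace A]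
    {ν₁ ν₂ : Measure (ℤ → A)} [IsProbabilityMeasure ν₁] [IsProbabilityMeasure ν₂]
    (hsing : ν₁ ⟂ₘ ν₂) {ζ : ℝ} (hζ : 0 < ζ) :
    ∃ (O : Set (ℤ → A)) (m : ℕ), 1 - ENNReal.ofReal ζ ≤ ν₁ (windowInterior O m) ∧
      ν₂ (windowInterior O m) ≤ ENNReal.ofReal ζ := by
  have hζ' : 0 < ENNReal.ofReal ζ := ENNReal.ofReal_pos.2 hζ
  obtain ⟨S, hS, hS₁, hS₂⟩ := hsing
  have : TopologicalSpace.MetrizableSpace (ℤ → A) :=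
    TopologicalSpace.metrizableSpace_of_t3_secondCountable _
  obtain ⟨O, hSO, hO, hO₂⟩ := Sᶜ.exists_isOpen_lt_of_lt (ENNReal.ofReal ζ) (hS₂.trans_lt hζ')
  have hO₁ : ν₁ O = 1 := by
    refine le_antisymm prob_le_one ?_
    rw [← (prob_compl_eq_one_iff hS).2 hS₁]
    exact measure_mono hSO
  have htend := tendsto_measure_iUnion_atTop (μ := ν₁) (monotone_windowInterior O)
  rw [iUnion_windowInterior hO, hO₁] at htend
  have hlt : 1 - ENNReal.ofReal ζ < 1 :=
    ENNReal.sub_lt_self ENNReal.one_ne_top one_ne_zero hζ'.ne'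
  obtain ⟨m, hm⟩ := (htend.eventually (lt_mem_nhds hlt)).exists
  exact ⟨O, m, hm.le, (measure_mono (windowInterior_subset O m)).trans hO₂.le⟩

theorem exists_mem_cylinder_of_mem_language {A : Type*} {X : Set (ℤ → A)} {w : List A}
    (hw : w ∈ language X) : ∃ x, x ∈ cylinder w := by
  obtain ⟨x, -, i, hi⟩ := hw
  exact ⟨fun k => x (i + k), hi⟩

theorem ofFn_mem_langN {A : Type*} {X : Set (ℤ → A)} {x : ℤ → A} (hx : x ∈ X) (n : ℕ) :
    List.ofFn (fun t : Fin n => x (t : ℕ)) ∈ langN X n :=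
  ⟨⟨x, hx, 0, fun t ht => by simp⟩, by simp⟩

theorem mem_cylinder_ofFn_s19 {A : Type*} {x y : ℤ → A} {n : ℕ} :
    y ∈ cylinder (List.ofFn (fun t : Fin n => x (t : ℕ))) ↔ ∀ t : ℕ, t < n → y t = x t := by
  simp [_root_.cylinder]

/-- Trimming a word moves its cylinder: a point of the trimmed cylinder reads the same
letters as a point of the original one, `i` places to the left. -/
theorem apply_eq_of_mem_cylinder_phi {A : Type*} {w : List A} {i j : ℕ} {y z : ℤ → A}
    (hy : y ∈ cylinder w) (hz : z ∈ cylinder (phi i j w)) {t : ℕ}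
    (ht : t + i + j < w.length) : z (t : ℤ) = y ((t + i : ℕ) : ℤ) := by
  rw [hz t (by simp [phi]; omega), hy (t + i) (by omega)]
  simp [phi, add_comm]

/-- Mutually singular invariant measures can be separated on cylinder collections,
stably under trimming. -/
theorem mutually_singular_separation {A : Type*} [Fintype A]
    [TopologicalSpace A] [DiscreteTopology A] [MeasurableSpace A] [BorelSpace A]
    (X : Set (ℤ → A)) (hX : IsShiftSpace X)
    (ν₁ ν₂ : Measure (ℤ → A))
    (h₁ : IsProbabilityMeasure ν₁) (h₂ : IsProbabilityMeasure ν₂)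
    (h₁X : ν₁ X = 1) (h₂X : ν₂ X = 1)
    (h₁inv : IsShiftInvariant ν₁) (h₂inv : IsShiftInvariant ν₂)
    (hsing : ν₁ ⟂ₘ ν₂) :
    ∀ ζ : ℝ, 0 < ζ →
      ∃ U : ℕ → Set (List A), ∃ n₀ : ℕ,
        (∀ n : ℕ, U n ⊆ langN X n) ∧
        (∀ n : ℕ, 1 - ENNReal.ofReal ζ ≤ ν₁ (⋃ w ∈ U n, cylinder w)) ∧
        (∀ i j n : ℕ, 2 * (n₀ + max i j) ≤ n →
          ν₂ (⋃ w ∈ phi i j '' U n, cylinder w) ≤ ENNReal.ofReal ζ) := by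
  intro ζ hζ
  obtain ⟨O, m, hV₁, hV₂⟩ := exists_windowInterior_separating hsing hζ
  have hV : MeasurableSet (windowInterior O m) := (isOpen_windowInterior O m).measurableSet
  refine ⟨fun n => {w | w ∈ langN X n ∧
    (2 * m ≤ n → ∀ x ∈ cylinder w, shift^[n / 2] x ∈ windowInterior O m)}, m,
    fun n w hw => hw.1, fun n => ?_, fun i j n hn => ?_⟩
  · have hX₀ : ν₁ Xᶜ = 0 := (prob_compl_eq_zero_iff hX.1.measurableSet).2 h₁X
    rw [← h₁inv.measure_preimage_iterate hV (n / 2), ← measure_inter_conull hX₀] at hV₁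
    refine hV₁.trans (measure_mono ?_)
    rintro x ⟨hxV, hxX⟩
    refine Set.mem_biUnion (x := List.ofFn (fun t : Fin n => x (t : ℕ)))
      ⟨ofFn_mem_langN hxX n, fun hmn y hy => ?_⟩ (mem_cylinder_ofFn_s19.2 fun _ _ => rfl)
    refine mem_windowInterior_of_agree hxV fun k hk₁ hk₂ => ?_
    rw [shift_iterate_apply, shift_iterate_apply]
    obtain ⟨t, ht⟩ := Int.eq_ofNat_of_zero_le (a := k + (n / 2 : ℕ)) (by omega)
    rw [ht]
    exact (mem_cylinder_ofFn_s19.1 hy t (by omega)).symm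
  · rw [← h₂inv.measure_preimage_iterate hV (n / 2 - i)] at hV₂
    refine (measure_mono (Set.iUnion₂_subset ?_)).trans hV₂
    rintro _ ⟨w, ⟨⟨hwL, hwn⟩, hwV⟩, rfl⟩ z hz
    obtain ⟨y, hy⟩ := exists_mem_cylinder_of_mem_language hwL
    refine mem_windowInterior_of_agree (hwV (by omega) y hy) fun k hk₁ hk₂ => ?_
    rw [shift_iterate_apply, shift_iterate_apply]
    obtain ⟨t, ht⟩ := Int.eq_ofNat_of_zero_le (a := k + (n / 2 - i : ℕ)) (by omega)
    rw [ht, apply_eq_of_mem_cylinder_phi hy hz (by omega)]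
    congr 1
    omega
end
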